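/- Let H : ℝ^{2d} → ℝ be measurable with ∫_{ℝ^{2d}} e^{−H} = 1, let ν be a positive integer, let h₀ > 0, and for each h ∈ (0,h₀) let Δ(·;h) : ℝ^{2d} → ℝ be measurable. Assume: (i) there exist measurable functions a and r(·;h) such that Δ(x;h) = h^ν a(x) + h^ν r(x;h) with r(x;h) → 0 as h → 0 for each fixed x; (ii) there is a function D(x), integrable with respect to the measure e^{−H(x)}dx, such that sup_{0<h<h₀} Δ(x;h)²/h^{2ν} ≤ D(x) for all x; (iii) for each h, Δ(·;h) = H ∘ Ψ_h − H where Ψ_h : ℝ^{2d} → ℝ^{2d} is a Lebesgue-measure-preserving bijection reversible with respect to the momentum flip S(q,p) = (q,−p), and H ∘ S = H. Define μ(h) = ∫ Δ(x;h) e^{−H(x)} dx, s²(h) = ∫ Δ(x;h)² e^{−H(x)} dx, and σ²(h) = s²(h) − μ(h)². Then lim_{h→0} μ(h)/h^{2ν} = Σ/2 and lim_{h→0} σ²(h)/h^{2ν} = Σ, where Σ = ∫ a(x)² e^{−H(x)} dx. -/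

import Mathlib

open MeasureTheory Filter

open scoped Topology

/-- The odd function `t ↦ tanh (t / 2)`, written with exponentials. -/
noncomputable def halfTanh (t : ℝ) : ℝ := 1 - 2 / (1 + Real.exp t)

theorem halfTanh_zero : halfTanh 0 = 0 := by
  norm_num [halfTanh]

theorem hasDerivAt_halfTanh_zero : HasDerivAt halfTanh (1 / 2) 0 := by
  have h1 : HasDerivAt (fun t : ℝ => 1 + Real.exp t) (Real.exp 0) 0 :=
    (Real.hasDerivAt_exp 0).const_add 1
  have h2 := ((hasDerivAt_const (0 : ℝ) (2 : ℝ)).div h1 (by positivity)).const_sub 1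
  refine h2.congr_deriv ?_
  norm_num

theorem abs_halfTanh_le (t : ℝ) : |halfTanh t| ≤ |t| := by
  have hp : 0 < 1 + Real.exp t := by positivity
  have hk : halfTanh t = (Real.exp t - 1) / (1 + Real.exp t) := by
    unfold halfTanh
    field_simp
    ring
  rw [hk, abs_div, abs_of_pos hp, div_le_iff₀ hp]
  have he := Real.exp_pos t
  rcases le_total 0 t with ht | ht
  · have h1 : 1 ≤ Real.exp t := Real.one_le_exp ht
    rw [abs_of_nonneg ht, abs_of_nonneg (by linarith)]
    have h2 := Real.add_one_le_exp (-t)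
    have h3 : Real.exp (-t) * Real.exp t = 1 := by rw [← Real.exp_add]; simp
    nlinarith
  · have h1 : Real.exp t ≤ 1 := Real.exp_le_one_iff.2 ht
    rw [abs_of_nonpos ht, abs_of_nonpos (by linarith)]
    have h2 := Real.add_one_le_exp t
    nlinarith

theorem halfTanh_eq_mul_dslope (t : ℝ) : halfTanh t = t * dslope halfTanh 0 t := by
  have h := sub_smul_dslope halfTanh 0 t
  simpa [halfTanh_zero] using h.symm

theorem tendsto_dslope_halfTanh :
    Tendsto (dslope halfTanh 0) (𝓝 0) (𝓝 (1 / 2)) := by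
  have h := continuousAt_dslope_same.2 hasDerivAt_halfTanh_zero.differentiableAt
  simpa [ContinuousAt, dslope_same, hasDerivAt_halfTanh_zero.deriv] using h

theorem measurable_halfTanh : Measurable halfTanh := by
  unfold halfTanh
  fun_prop

section Involution

variable {α : Type*} [MeasurableSpace α] {μ : Measure α} {T : α → α} {H : α → ℝ}

/-- The mean energy error of a measure-preserving involution is the integral of
`Δ tanh (Δ / 2)` against the Boltzmann–Gibbs density. -/
theorem integral_energyError_of_involutive (hT : MeasurePreserving T μ μ)
    (hTT : Function.Involutive T) (hH : Measurable H)
    (hinteg : Integrable (fun x => (H (T x) - H x) * Real.exp (-H x)) μ) :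
    ∫ x, (H (T x) - H x) * Real.exp (-H x) ∂μ =
      ∫ x, (H (T x) - H x) * halfTanh (H (T x) - H x) * Real.exp (-H x) ∂μ := by
  have hTm := hT.measurable
  set g : α → ℝ := fun x =>
    (H (T x) - H x) / (1 + Real.exp (H (T x) - H x)) * Real.exp (-H x) with hg
  have hgint : Integrable g μ := by
    refine hinteg.mono (by fun_prop) (ae_of_all _ fun x => ?_)
    simp only [hg, norm_mul, norm_div]
    gcongr
    refine div_le_self (norm_nonneg _) ?_
    rw [Real.norm_eq_abs, abs_of_pos (by positivity)]
    linarith [Real.exp_pos (H (T x) - H x)]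
  have hgT : ∀ x, g (T x) = -g x := by
    intro x
    simp only [hg, hTT x]
    have h1 : Real.exp (H x - H (T x)) * Real.exp (H (T x) - H x) = 1 := by
      rw [← Real.exp_add]; simp
    have h2 : Real.exp (-H (T x)) * Real.exp (H (T x) - H x) = Real.exp (-H x) := by
      rw [← Real.exp_add]; congr 1; ring
    rw [← h2]
    have h3 : 0 < 1 + Real.exp (H (T x) - H x) := by positivity
    have h4 : 0 < 1 + Real.exp (H x - H (T x)) := by positivity
    field_simp
    linear_combination (H (T x) - H x) * h1
  have hg0 : ∫ x, g x ∂μ = 0 := by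
    have h1 : ∫ x, g (T x) ∂μ = ∫ x, g x ∂μ :=
      hT.integral_comp (MeasurableEquiv.ofInvolutive T hTT hTm).measurableEmbedding g
    simp only [hgT, integral_neg] at h1
    linarith
  have h2 : ∀ x, (H (T x) - H x) * halfTanh (H (T x) - H x) * Real.exp (-H x) =
      (H (T x) - H x) * Real.exp (-H x) - 2 * g x := by
    intro x
    simp only [hg, halfTanh]
    ring
  simp only [h2]
  rw [integral_sub hinteg (hgint.const_mul 2), integral_const_mul, hg0]
  ring

end Involution

theorem measurePreserving_momentumFlip (d : ℕ) :
    MeasurePreserving (fun x : (Fin d → ℝ) × (Fin d → ℝ) => (x.1, -x.2)) volume volume :=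
  (MeasurePreserving.id volume).prod (Measure.measurePreserving_neg volume)

/-- The mean energy error of a volume-preserving reversible map. -/
theorem integral_energyError_of_reversible {d : ℕ} {H : (Fin d → ℝ) × (Fin d → ℝ) → ℝ}
    (hH : Measurable H) (hHS : ∀ x : (Fin d → ℝ) × (Fin d → ℝ), H (x.1, -x.2) = H x)
    {Ψ : ((Fin d → ℝ) × (Fin d → ℝ)) ≃ ((Fin d → ℝ) × (Fin d → ℝ))}
    (hΨ : MeasurePreserving Ψ volume volume)
    (hrev : ∀ x, ((Ψ x).1, -(Ψ x).2) = Ψ.symm (x.1, -x.2))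
    (hinteg : Integrable (fun x => (H (Ψ x) - H x) * Real.exp (-H x))) :
    ∫ x, (H (Ψ x) - H x) * Real.exp (-H x) =
      ∫ x, (H (Ψ x) - H x) * halfTanh (H (Ψ x) - H x) * Real.exp (-H x) := by
  have hT := (measurePreserving_momentumFlip d).comp hΨ
  have hTT : Function.Involutive
      ((fun x : (Fin d → ℝ) × (Fin d → ℝ) => (x.1, -x.2)) ∘ Ψ) := by
    intro x
    have h := hrev ((Ψ x).1, -(Ψ x).2)
    simpa using h
  have h := integral_energyError_of_involutive hT hTT hH
  simp only [Function.comp_apply, hHS] at h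
  exact h hinteg

/-- Let `H` be measurable on `ℝ^{2d}` with `∫ e^{-H} = 1`, `ν ≥ 1`,
`h₀ > 0`, and for `h ∈ (0,h₀)` let `Δ(·;h) = H ∘ Ψ_h − H` be the energy error of a
volume-preserving bijection `Ψ_h` reversible with respect to the momentum flip, where
`H` is invariant under the momentum flip.  Assume `Δ(x;h) = h^ν a(x) + h^ν r(x;h)` with
`r(x;h) → 0` as `h → 0⁺` for each `x`, and `Δ(x;h)²/h^{2ν} ≤ D(x)` with `D e^{-H}`
integrable.  Then `μ(h)/h^{2ν} → Σ/2` and `σ²(h)/h^{2ν} → Σ`, where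
`Σ = ∫ a² e^{-H}`, `μ(h) = ∫ Δ e^{-H}`, `σ²(h) = ∫ Δ² e^{-H} − μ(h)²`. -/
theorem one_component_mean_energy_error_asymptotics
    (d : ℕ) (H : (Fin d → ℝ) × (Fin d → ℝ) → ℝ) (hH : Measurable H)
    (hexpint : Integrable (fun x => Real.exp (-H x)))
    (hnorm : (∫ x, Real.exp (-H x)) = 1)
    (ν : ℕ) (hν : 0 < ν) (h₀ : ℝ) (hh₀ : 0 < h₀)
    (Δ : ℝ → ((Fin d → ℝ) × (Fin d → ℝ)) → ℝ)
    (a : ((Fin d → ℝ) × (Fin d → ℝ)) → ℝ) (ha : Measurable a)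
    (r : ℝ → ((Fin d → ℝ) × (Fin d → ℝ)) → ℝ)
    (hdecomp : ∀ h ∈ Set.Ioo 0 h₀, ∀ x, Δ h x = h ^ ν * a x + h ^ ν * r h x)
    (hr : ∀ x, Tendsto (fun h => r h x) (nhdsWithin 0 (Set.Ioi 0)) (nhds 0))
    (Dbnd : ((Fin d → ℝ) × (Fin d → ℝ)) → ℝ)
    (hDint : Integrable (fun x => Dbnd x * Real.exp (-H x)))
    (hDbound : ∀ h ∈ Set.Ioo 0 h₀, ∀ x, Δ h x ^ 2 / h ^ (2 * ν) ≤ Dbnd x)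
    (Ψ : ℝ → ((Fin d → ℝ) × (Fin d → ℝ)) ≃ ((Fin d → ℝ) × (Fin d → ℝ)))
    (hΨ : ∀ h ∈ Set.Ioo 0 h₀, MeasurePreserving (Ψ h) volume volume)
    (hΨrev : ∀ h ∈ Set.Ioo 0 h₀, ∀ x : (Fin d → ℝ) × (Fin d → ℝ),
      ((Ψ h x).1, -(Ψ h x).2) = (Ψ h).symm (x.1, -x.2))
    (hHS : ∀ x : (Fin d → ℝ) × (Fin d → ℝ), H (x.1, -x.2) = H x)
    (hΔdef : ∀ h ∈ Set.Ioo 0 h₀, ∀ x, Δ h x = H (Ψ h x) - H x) :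
    Tendsto (fun h => (∫ x, Δ h x * Real.exp (-H x)) / h ^ (2 * ν))
        (nhdsWithin 0 (Set.Ioi 0))
        (nhds ((∫ x, a x ^ 2 * Real.exp (-H x)) / 2)) ∧
    Tendsto (fun h =>
        ((∫ x, Δ h x ^ 2 * Real.exp (-H x)) - (∫ x, Δ h x * Real.exp (-H x)) ^ 2)
          / h ^ (2 * ν))
        (nhdsWithin 0 (Set.Ioi 0))
        (nhds (∫ x, a x ^ 2 * Real.exp (-H x))) := by
  set l : Filter ℝ := nhdsWithin 0 (Set.Ioi 0) with hl
  have hmem : ∀ᶠ h in l, h ∈ Set.Ioo 0 h₀ := Ioo_mem_nhdsGT hh₀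
  have hΔm : ∀ h ∈ Set.Ioo 0 h₀, Measurable (Δ h) := by
    intro h hh
    have h1 := (hΨ h hh).measurable
    rw [funext (hΔdef h hh)]
    fun_prop
  have hscaled : ∀ x, Tendsto (fun h => Δ h x / h ^ ν) l (𝓝 (a x)) := by
    intro x
    have h1 : Tendsto (fun h => a x + r h x) l (𝓝 (a x)) := by
      simpa using (hr x).const_add (a x)
    refine h1.congr' ?_
    filter_upwards [hmem] with h hh
    have hp : 0 < h ^ ν := pow_pos hh.1 ν
    rw [hdecomp h hh x]
    field_simp
  have hpow : ∀ n : ℕ, 0 < n → Tendsto (fun h : ℝ => h ^ n) l (𝓝 0) := by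
    intro n hn
    have h1 : Tendsto (fun h : ℝ => h ^ n) (𝓝 0) (𝓝 (0 ^ n)) :=
      (continuous_pow n).tendsto 0
    rw [zero_pow hn.ne'] at h1
    exact h1.mono_left nhdsWithin_le_nhds
  have hΔ0 : ∀ x, Tendsto (fun h => Δ h x) l (𝓝 0) := by
    intro x
    have h1 := (hscaled x).mul (hpow ν hν)
    rw [mul_zero] at h1
    refine h1.congr' ?_
    filter_upwards [hmem] with h hh
    exact div_mul_cancel₀ _ (pow_pos hh.1 ν).ne'
  have hsq : ∀ x, Tendsto (fun h => Δ h x ^ 2 / h ^ (2 * ν)) l (𝓝 (a x ^ 2)) := by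
    intro x
    refine ((hscaled x).pow 2).congr fun h => ?_
    rw [div_pow, ← pow_mul, mul_comm ν 2]
  have hs2 : Tendsto (fun h => (∫ x, Δ h x ^ 2 * Real.exp (-H x)) / h ^ (2 * ν)) l
      (𝓝 (∫ x, a x ^ 2 * Real.exp (-H x))) := by
    simp only [← integral_div]
    refine tendsto_integral_filter_of_dominated_convergence
      (fun x => Dbnd x * Real.exp (-H x)) ?_ ?_ hDint ?_
    · filter_upwards [hmem] with h hh
      have := hΔm h hh
      fun_prop
    · filter_upwards [hmem] with h hh
      refine ae_of_all _ fun x => ?_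
      have hp : 0 < h ^ (2 * ν) := pow_pos hh.1 _
      rw [Real.norm_eq_abs, abs_of_nonneg (by positivity), mul_div_right_comm]
      exact mul_le_mul_of_nonneg_right (hDbound h hh x) (Real.exp_pos _).le
    · refine ae_of_all _ fun x => ?_
      refine ((hsq x).mul_const (Real.exp (-H x))).congr fun h => ?_
      ring
  have hinteg : ∀ h ∈ Set.Ioo 0 h₀, Integrable (fun x => Δ h x * Real.exp (-H x)) := by
    intro h hh
    have hm := hΔm h hh
    have hp : 0 < h ^ (2 * ν) := pow_pos hh.1 _
    refine (hexpint.add (hDint.const_mul (h ^ (2 * ν)))).mono' (by fun_prop)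
      (ae_of_all _ fun x => ?_)
    have h1 := hDbound h hh x
    rw [div_le_iff₀ hp] at h1
    have h2 : |Δ h x| ≤ 1 + h ^ (2 * ν) * Dbnd x := by
      nlinarith [sq_nonneg (|Δ h x| - 1), sq_abs (Δ h x)]
    have h3 := mul_le_mul_of_nonneg_right h2 (Real.exp_pos (-H x)).le
    rw [norm_mul, Real.norm_eq_abs, Real.norm_eq_abs, abs_of_pos (Real.exp_pos _)]
    refine h3.trans (le_of_eq ?_)
    simp only [Pi.add_apply]
    ring
  have hmean : Tendsto (fun h => (∫ x, Δ h x * Real.exp (-H x)) / h ^ (2 * ν)) l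
      (𝓝 ((∫ x, a x ^ 2 * Real.exp (-H x)) / 2)) := by
    have hid : (fun h => (∫ x, Δ h x * halfTanh (Δ h x) * Real.exp (-H x) / h ^ (2 * ν)))
        =ᶠ[l] fun h => (∫ x, Δ h x * Real.exp (-H x)) / h ^ (2 * ν) := by
      filter_upwards [hmem] with h hh
      have h1 := hinteg h hh
      rw [integral_div]
      simp only [hΔdef h hh] at h1 ⊢
      rw [integral_energyError_of_reversible hH hHS (hΨ h hh) (hΨrev h hh) h1]
    refine Tendsto.congr' hid ?_
    rw [← integral_div]
    refine tendsto_integral_filter_of_dominated_convergence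
      (fun x => Dbnd x * Real.exp (-H x)) ?_ ?_ hDint ?_
    · filter_upwards [hmem] with h hh
      have h1 := hΔm h hh
      have h2 := measurable_halfTanh.comp h1
      exact (((h1.mul h2).mul (Real.measurable_exp.comp hH.neg)).div_const _).aestronglyMeasurable
    · filter_upwards [hmem] with h hh
      refine ae_of_all _ fun x => ?_
      have hp : 0 < h ^ (2 * ν) := pow_pos hh.1 _
      rw [mul_div_right_comm, norm_mul, norm_div, norm_mul, Real.norm_eq_abs, Real.norm_eq_abs,
        Real.norm_eq_abs, Real.norm_eq_abs, abs_of_pos hp, abs_of_pos (Real.exp_pos _)]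
      refine mul_le_mul_of_nonneg_right (le_trans ?_ (hDbound h hh x)) (Real.exp_pos _).le
      gcongr
      rw [← sq_abs, sq]
      exact mul_le_mul_of_nonneg_left (abs_halfTanh_le _) (abs_nonneg _)
    · refine ae_of_all _ fun x => ?_
      have h1 := ((hsq x).mul (tendsto_dslope_halfTanh.comp (hΔ0 x))).mul_const (Real.exp (-H x))
      have h2 : a x ^ 2 * (1 / 2) * Real.exp (-H x) = a x ^ 2 * Real.exp (-H x) / 2 := by ring
      rw [h2] at h1
      refine h1.congr fun h => ?_
      rw [Function.comp_apply, halfTanh_eq_mul_dslope]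
      ring
  refine ⟨hmean, ?_⟩
  have hfinal := hs2.sub ((hmean.pow 2).mul (hpow (2 * ν) (by omega)))
  rw [mul_zero, sub_zero] at hfinal
  refine hfinal.congr' ?_
  filter_upwards [hmem] with h hh
  have hp : 0 < h ^ (2 * ν) := pow_pos hh.1 _
  field_simp
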